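/- arXiv:0909.1817 — 2 statements merged into one kernel-verified Lean document; each statement's English description precedes it below -/
import Mathlib

section
/- (Optimal correlation, rank-deficient case.) Assume P₁, P₂ ≥ 0 and det(H†H) = 0. Let ρ* = e^{i·arg(h₁†h₂)} (with the convention e^{i·arg(0)} = 1), i.e. |ρ*| = 1 with phase equal to that of h₁†h₂. Then for every ρ ∈ ℂ with |ρ| ≤ 1, det(I_N + H Q_r(ρ) H†) ≤ det(I_N + H Q_r(ρ*) H†): full correlation between the two relay signals is optimal when the relays-to-destination channel is rank-deficient. -/
open Matrix Complex Filter

/-- The `N × 2` matrix with columns `h₁` and `h₂`. -/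
noncomputable def Hm {N : ℕ} (h₁ h₂ : Fin N → ℂ) : Matrix (Fin N) (Fin 2) ℂ :=
  Matrix.of fun i j => if j = 0 then h₁ i else h₂ i

/-- The Hermitian inner product `h₁† h₂ = ∑ i, conj (h₁ i) * h₂ i`. -/
noncomputable def ip {N : ℕ} (h₁ h₂ : Fin N → ℂ) : ℂ :=
  ∑ i, (starRingEnd ℂ) (h₁ i) * h₂ i

/-- The squared Euclidean norm `‖h‖²`. -/
noncomputable def nsq {N : ℕ} (h : Fin N → ℂ) : ℝ :=
  ∑ i, Complex.normSq (h i)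

/-- `det (H† H)`, a nonnegative real number (taken via the real part). -/
noncomputable def detHH {N : ℕ} (h₁ h₂ : Fin N → ℂ) : ℝ :=
  (((Hm h₁ h₂)ᴴ * Hm h₁ h₂).det).re

/-- The relay covariance matrix `Q_r(ρ)` with diagonal `P₁, P₂` and
off-diagonal `ρ √(P₁ P₂)`. -/
noncomputable def Qr (P₁ P₂ : ℝ) (ρ : ℂ) : Matrix (Fin 2) (Fin 2) ℂ :=
  !![(P₁ : ℂ), ρ * (Real.sqrt (P₁ * P₂) : ℂ);
     (starRingEnd ℂ) ρ * (Real.sqrt (P₁ * P₂) : ℂ), (P₂ : ℂ)]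

/-- `det (I_N + H Q_r(ρ) H†)` (a real number, taken via the real part). -/
noncomputable def MACdet {N : ℕ} (h₁ h₂ : Fin N → ℂ) (P₁ P₂ : ℝ) (ρ : ℂ) : ℝ :=
  ((1 + Hm h₁ h₂ * Qr P₁ P₂ ρ * (Hm h₁ h₂)ᴴ).det).re

theorem conjTranspose_Hm_mul_Hm {N : ℕ} (h₁ h₂ : Fin N → ℂ) :
    (Hm h₁ h₂)ᴴ * Hm h₁ h₂ =
      !![(nsq h₁ : ℂ), ip h₁ h₂; (starRingEnd ℂ) (ip h₁ h₂), (nsq h₂ : ℂ)] := by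
  ext i j
  fin_cases i <;> fin_cases j <;>
    simp [Hm, ip, nsq, Matrix.mul_apply, Complex.normSq_eq_conj_mul_self, mul_comm]

/-- In general the determinant is affine in `ρ` up to the term `det Q_r(ρ) · det (H† H)`. -/
theorem MACdet_eq_of_detHH_eq_zero {N : ℕ} {h₁ h₂ : Fin N → ℂ} (P₁ P₂ : ℝ)
    (hD : detHH h₁ h₂ = 0) (ρ : ℂ) :
    MACdet h₁ h₂ P₁ P₂ ρ = 1 + P₁ * nsq h₁ + P₂ * nsq h₂ +
      2 * Real.sqrt (P₁ * P₂) * (ρ * (starRingEnd ℂ) (ip h₁ h₂)).re := by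
  rw [detHH, conjTranspose_Hm_mul_Hm, Matrix.det_fin_two_of] at hD
  rw [MACdet, Matrix.mul_assoc, Matrix.det_one_add_mul_comm, Matrix.mul_assoc,
    conjTranspose_Hm_mul_Hm, Qr, Matrix.one_fin_two]
  simp [Matrix.det_fin_two] at hD ⊢
  linear_combination (P₁ * P₂ - (ρ.re ^ 2 + ρ.im ^ 2) * Real.sqrt (P₁ * P₂) ^ 2) * hD

theorem re_exp_I_mul_arg_mul_conj (z : ℂ) :
    (Complex.exp (Complex.I * (z.arg : ℂ)) * (starRingEnd ℂ) z).re = ‖z‖ := by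
  have h : Complex.exp (Complex.I * (z.arg : ℂ)) * (starRingEnd ℂ) z = (‖z‖ : ℂ) := by
    nth_rw 2 [← Complex.norm_mul_exp_arg_mul_I z]
    rw [map_mul, Complex.conj_ofReal, ← Complex.exp_conj, mul_left_comm, ← Complex.exp_add]
    simp [mul_comm]
  rw [h, Complex.ofReal_re]

/-- Optimal correlation, rank-deficient case. If `P₁, P₂ ≥ 0` and
`det(H†H) = 0`, then full correlation `ρ* = e^{i·arg(h₁†h₂)}` (so `|ρ*| = 1`)
maximizes `det (I_N + H Q_r(ρ) H†)` over all `ρ` with `|ρ| ≤ 1`. -/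
theorem stmt3 {N : ℕ} (hN : 0 < N) (h₁ h₂ : Fin N → ℂ) (P₁ P₂ : ℝ)
    (hP₁ : 0 ≤ P₁) (hP₂ : 0 ≤ P₂) (hD : detHH h₁ h₂ = 0)
    (ρ : ℂ) (hρ : ‖ρ‖ ≤ 1) :
    MACdet h₁ h₂ P₁ P₂ ρ ≤
      MACdet h₁ h₂ P₁ P₂ (Complex.exp (Complex.I * ((ip h₁ h₂).arg : ℂ))) := by
  rw [MACdet_eq_of_detHH_eq_zero P₁ P₂ hD, MACdet_eq_of_detHH_eq_zero P₁ P₂ hD,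
    re_exp_I_mul_arg_mul_conj]
  gcongr
  calc (ρ * (starRingEnd ℂ) (ip h₁ h₂)).re
      ≤ ‖ρ * (starRingEnd ℂ) (ip h₁ h₂)‖ := Complex.re_le_norm _
    _ = ‖ρ‖ * ‖ip h₁ h₂‖ := by rw [norm_mul, Complex.norm_conj]
    _ ≤ ‖ip h₁ h₂‖ := mul_le_of_le_one_left (norm_nonneg _) hρ
end

section
/- (Benefit of correlation.) Assume P₁ > 0 and P₂ > 0. Then det(I_N + H Q_r(0) H†) ≤ max over ρ ∈ ℂ with |ρ| ≤ 1 of det(I_N + H Q_r(ρ) H†), where Q_r(0) = diag(P₁, P₂), and equality holds if and only if h₁†h₂ = 0. -/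
open Matrix Complex Filter

theorem MACdet_eq {N : ℕ} (h₁ h₂ : Fin N → ℂ) {P₁ P₂ : ℝ} (hP : 0 ≤ P₁ * P₂) (ρ : ℂ) :
    MACdet h₁ h₂ P₁ P₂ ρ = 1 + P₁ * nsq h₁ + P₂ * nsq h₂ +
      2 * Real.sqrt (P₁ * P₂) * (ρ * (starRingEnd ℂ) (ip h₁ h₂)).re +
      P₁ * P₂ * (1 - normSq ρ) * (nsq h₁ * nsq h₂ - normSq (ip h₁ h₂)) := by
  have gram : (Hm h₁ h₂)ᴴ * Hm h₁ h₂ =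
      !![(nsq h₁ : ℂ), ip h₁ h₂; (starRingEnd ℂ) (ip h₁ h₂), (nsq h₂ : ℂ)] := by
    ext i j
    fin_cases i <;> fin_cases j <;>
      simp [Matrix.mul_apply, Hm, nsq, ip, Complex.normSq_eq_conj_mul_self, mul_comm]
  have hs : Real.sqrt (P₁ * P₂) * Real.sqrt (P₁ * P₂) = P₁ * P₂ := Real.mul_self_sqrt hP
  rw [MACdet, Matrix.mul_assoc, Matrix.det_one_add_mul_comm, Matrix.mul_assoc, gram, Qr,
    Matrix.det_fin_two]
  generalize Real.sqrt (P₁ * P₂) = s at *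
  simp [Complex.normSq_apply]
  linear_combination -(ρ.re ^ 2 + ρ.im ^ 2) *
    (nsq h₁ * nsq h₂ - ((ip h₁ h₂).re ^ 2 + (ip h₁ h₂).im ^ 2)) * hs

theorem continuous_MACdet {N : ℕ} (h₁ h₂ : Fin N → ℂ) {P₁ P₂ : ℝ} (hP : 0 ≤ P₁ * P₂) :
    Continuous (MACdet h₁ h₂ P₁ P₂) := by
  simp only [funext (MACdet_eq h₁ h₂ hP)]
  have := Complex.continuous_normSq
  fun_prop

theorem nsq_nonneg {N : ℕ} (h : Fin N → ℂ) : 0 ≤ nsq h :=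
  Finset.sum_nonneg fun _ _ => Complex.normSq_nonneg _

/-- If the columns are not orthogonal, some admissible correlation strictly increases the
determinant: a small positive multiple of `h₁†h₂` does. -/
theorem exists_MACdet_zero_lt {N : ℕ} {h₁ h₂ : Fin N → ℂ} {P₁ P₂ : ℝ} (hP : 0 < P₁ * P₂)
    (hc : ip h₁ h₂ ≠ 0) : ∃ ρ : ℂ, ‖ρ‖ ≤ 1 ∧ MACdet h₁ h₂ P₁ P₂ 0 < MACdet h₁ h₂ P₁ P₂ ρ := by
  have hs : 0 < Real.sqrt (P₁ * P₂) := Real.sqrt_pos.2 hP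
  have hss := Real.mul_self_sqrt hP.le
  have hn : 0 < normSq (ip h₁ h₂) := Complex.normSq_pos.2 hc
  simp only [MACdet_eq h₁ h₂ hP.le]
  generalize Real.sqrt (P₁ * P₂) = s at *
  generalize ip h₁ h₂ = c at *
  generalize hD : nsq h₁ * nsq h₂ - normSq c = D
  have hd : 0 < 1 + ‖c‖ + s * |D| := by positivity
  obtain ⟨t, ht⟩ : ∃ t : ℝ, t = (1 + ‖c‖ + s * |D|)⁻¹ := ⟨_, rfl⟩
  have ht0 : 0 < t := ht ▸ inv_pos.2 hd
  have htd : t * (1 + ‖c‖ + s * |D|) = 1 := ht ▸ inv_mul_cancel₀ hd.ne'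
  have h1 : 0 ≤ t * ‖c‖ := by positivity
  have h2 : 0 ≤ t * (s * |D|) := by positivity
  have h3 : t * (s * D) ≤ t * (s * |D|) := by gcongr; exact le_abs_self D
  refine ⟨t * c, ?_, ?_⟩
  · rw [norm_mul, Complex.norm_real, Real.norm_of_nonneg ht0.le]
    linarith
  · have hre : ((t : ℂ) * c * (starRingEnd ℂ) c).re = t * normSq c := by
      rw [mul_assoc, Complex.mul_conj, ← Complex.ofReal_mul, Complex.ofReal_re]
    have key : 0 < s * t * normSq c * (2 - t * (s * D)) :=
      mul_pos (by positivity) (by linarith)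
    rw [hre, Complex.normSq_mul, Complex.normSq_ofReal, ← hss]
    simp only [zero_mul, Complex.zero_re, map_zero]
    linarith

/-- Benefit of correlation. For `P₁, P₂ > 0`, the value
`det (I_N + H Q_r(0) H†)` (uncorrelated relays, `Q_r(0) = diag(P₁,P₂)`) is at most the
maximum of `det (I_N + H Q_r(ρ) H†)` over `|ρ| ≤ 1`, with equality iff `h₁†h₂ = 0`. -/
theorem stmt6 {N : ℕ} (hN : 0 < N) (h₁ h₂ : Fin N → ℂ) (P₁ P₂ : ℝ)
    (hP₁ : 0 < P₁) (hP₂ : 0 < P₂) :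
    ∃ m : ℝ,
      IsGreatest {x : ℝ | ∃ ρ : ℂ, ‖ρ‖ ≤ 1 ∧ x = MACdet h₁ h₂ P₁ P₂ ρ} m ∧
      MACdet h₁ h₂ P₁ P₂ 0 ≤ m ∧
      (MACdet h₁ h₂ P₁ P₂ 0 = m ↔ ip h₁ h₂ = 0) := by
  have hP : 0 < P₁ * P₂ := mul_pos hP₁ hP₂
  obtain ⟨ρ₀, hρ₀, hmax⟩ := (isCompact_closedBall (0 : ℂ) 1).exists_isMaxOn
    ⟨0, by simp⟩ (continuous_MACdet h₁ h₂ hP.le).continuousOn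
  rw [mem_closedBall_zero_iff] at hρ₀
  have hle : ∀ ρ : ℂ, ‖ρ‖ ≤ 1 → MACdet h₁ h₂ P₁ P₂ ρ ≤ MACdet h₁ h₂ P₁ P₂ ρ₀ :=
    fun ρ hρ => hmax (mem_closedBall_zero_iff.2 hρ)
  have h0 := hle 0 (by simp)
  refine ⟨MACdet h₁ h₂ P₁ P₂ ρ₀, ⟨⟨ρ₀, hρ₀, rfl⟩, ?_⟩, h0, fun h => ?_, fun h => ?_⟩
  · rintro _ ⟨ρ, hρ, rfl⟩
    exact hle ρ hρ
  · by_contra hc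
    obtain ⟨ρ, hρ, hlt⟩ := exists_MACdet_zero_lt hP hc
    exact (h ▸ hlt).not_ge (hle ρ hρ)
  · refine h0.antisymm ?_
    have hnn : 0 ≤ P₁ * P₂ * normSq ρ₀ * (nsq h₁ * nsq h₂) :=
      mul_nonneg (mul_nonneg hP.le (Complex.normSq_nonneg _))
        (mul_nonneg (nsq_nonneg h₁) (nsq_nonneg h₂))
    simp only [MACdet_eq h₁ h₂ hP.le, h, map_zero, mul_zero, Complex.zero_re]
    linarith
end
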